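/- Run IR-ISTA with a constant regularization parameter η > 0 and stepsize γ ≤ 1/(L_h + ηL_f). Suppose X*_h̄ is an α-weak sharp minima of order m = 1 and η ≤ α/(2‖∇̃f̄(x*)‖). Set q := 1 − ηγμ_f ∈ (0,1). Then for every K ≥ 1: (a) 0 ≤ h̄(x̄_K) − h̄* ≤ (‖x_0 − x*‖²/γ)·q^K; (b) dist(x̄_K, X*_h̄) ≤ (‖x_0 − x*‖²/(αγ))·q^K; (c) −(‖x_0 − x*‖²/(2ηγ))·q^K ≤ f̄(x̄_K) − f̄* ≤ (‖x_0 − x*‖²/(2ηγ))·q^K; (d) ‖x̄_K − x*‖² ≤ (2‖x_0 − x*‖²/(ηγμ_f))·q^K. -/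

import Mathlib

open scoped RealInnerProductSpace
open Metric Filter

noncomputable section

section ProximalGradient

variable {E : Type*} [NormedAddCommGroup E] [InnerProductSpace ℝ E]

theorem StrongConvexOn.secant_le {m : ℝ} {f : E → ℝ} (hf : StrongConvexOn Set.univ m f)
    (x y : E) {t : ℝ} (ht₀ : 0 < t) (ht₁ : t < 1) :
    t⁻¹ * (f (x + t • (y - x)) - f x) ≤ f y - f x - (1 - t) * (m / 2 * ‖y - x‖ ^ 2) := by
  have key := hf.2 (Set.mem_univ x) (Set.mem_univ y) (sub_nonneg.2 ht₁.le) ht₀.le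
    (sub_add_cancel 1 t)
  have hpt : (1 - t) • x + t • y = x + t • (y - x) := by module
  rw [hpt, norm_sub_rev x y] at key
  simp only [smul_eq_mul] at key
  rw [inv_mul_le_iff₀ ht₀]
  linarith

theorem tendsto_secant_bound (a b : ℝ) :
    Tendsto (fun t : ℝ ↦ a - (1 - t) * b) (nhdsWithin 0 (Set.Ioi 0)) (nhds (a - b)) := by
  have : Continuous fun t : ℝ ↦ a - (1 - t) * b := by fun_prop
  simpa using (this.tendsto 0).mono_left nhdsWithin_le_nhds

theorem StrongConvexOn.add_inner_add_sq_le_of_subgradient {m : ℝ} {f : E → ℝ}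
    (hf : StrongConvexOn Set.univ m f) {x g : E} (hg : ∀ y, f x + ⟪g, y - x⟫ ≤ f y) (y : E) :
    f x + ⟪g, y - x⟫ + m / 2 * ‖y - x‖ ^ 2 ≤ f y := by
  have hle : ⟪g, y - x⟫ ≤ f y - f x - m / 2 * ‖y - x‖ ^ 2 := by
    refine ge_of_tendsto (tendsto_secant_bound _ _) ?_
    filter_upwards [Ioo_mem_nhdsGT (zero_lt_one' ℝ)] with t ht
    refine le_trans ?_ (hf.secant_le x y ht.1 ht.2)
    rw [le_inv_mul_iff₀ ht.1]
    have := hg (x + t • (y - x))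
    rw [add_sub_cancel_left, inner_smul_right] at this
    linarith
  linarith

theorem HasGradientAt.hasDerivAt_line [CompleteSpace E] {f : E → ℝ} {g x v : E} {t : ℝ}
    (hg : HasGradientAt f g (x + t • v)) :
    HasDerivAt (fun s : ℝ ↦ f (x + s • v)) ⟪g, v⟫ t := by
  have hline : HasDerivAt (fun s : ℝ ↦ x + s • v) v t := by
    simpa using ((hasDerivAt_id t).smul_const v).const_add x
  simpa using! hg.hasFDerivAt.comp_hasDerivAt t hline

theorem StrongConvexOn.add_inner_add_sq_le_of_hasGradientAt [CompleteSpace E] {m : ℝ} {f : E → ℝ}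
    (hf : StrongConvexOn Set.univ m f) {x g : E} (hg : HasGradientAt f g x) (y : E) :
    f x + ⟪g, y - x⟫ + m / 2 * ‖y - x‖ ^ 2 ≤ f y := by
  have hd : HasDerivAt (fun s : ℝ ↦ f (x + s • (y - x))) ⟪g, y - x⟫ 0 :=
    HasGradientAt.hasDerivAt_line (by simpa using hg)
  have hle : ⟪g, y - x⟫ ≤ f y - f x - m / 2 * ‖y - x‖ ^ 2 := by
    refine le_of_tendsto_of_tendsto hd.tendsto_slope_zero_right (tendsto_secant_bound _ _) ?_
    filter_upwards [Ioo_mem_nhdsGT (zero_lt_one' ℝ)] with t ht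
    simpa using hf.secant_le x y ht.1 ht.2
  linarith

theorem le_add_inner_add_sq_of_lipschitz_gradient [CompleteSpace E] {L : ℝ} {f : E → ℝ}
    {f' : E → E} (hf : ∀ x, HasGradientAt f (f' x) x)
    (hL : ∀ x y, ‖f' x - f' y‖ ≤ L * ‖x - y‖) (x y : E) :
    f y ≤ f x + ⟪f' x, y - x⟫ + L / 2 * ‖y - x‖ ^ 2 := by
  set v := y - x with hv
  let ψ : ℝ → ℝ := fun t ↦ f (x + t • v) - (t * ⟪f' x, v⟫ + L / 2 * ‖v‖ ^ 2 * t ^ 2)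
  have hψ (t : ℝ) :
      HasDerivAt ψ (⟪f' (x + t • v), v⟫ - (⟪f' x, v⟫ + L / 2 * ‖v‖ ^ 2 * (2 * t))) t := by
    have h₁ := (hasDerivAt_id t).mul_const ⟪f' x, v⟫
    have h₂ := (hasDerivAt_pow 2 t).const_mul (L / 2 * ‖v‖ ^ 2)
    simpa using! (HasGradientAt.hasDerivAt_line (hf (x + t • v))).sub (h₁.add h₂)
  have hanti : AntitoneOn ψ (Set.Ici 0) := by
    refine antitoneOn_of_deriv_nonpos (convex_Ici 0)
      (fun t _ ↦ (hψ t).continuousAt.continuousWithinAt)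
      (fun t _ ↦ (hψ t).differentiableAt.differentiableWithinAt) fun t ht ↦ ?_
    rw [interior_Ici] at ht
    rw [(hψ t).deriv]
    have h₁ := real_inner_le_norm (f' (x + t • v) - f' x) v
    have h₂ := hL (x + t • v) x
    rw [add_sub_cancel_left, norm_smul, Real.norm_of_nonneg (le_of_lt ht)] at h₂
    have h₃ := mul_le_mul_of_nonneg_right h₂ (norm_nonneg v)
    rw [inner_sub_left] at h₁
    nlinarith
  have h₁ := hanti Set.self_mem_Ici (Set.mem_Ici.2 zero_le_one) zero_le_one
  simp only [ψ, hv, one_smul, zero_smul, add_sub_cancel, add_zero] at h₁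
  linarith

theorem ConvexOn.strongConvexOn_add_sq {c : ℝ} {ω : E → ℝ} (hω : ConvexOn ℝ Set.univ ω) (w : E) :
    StrongConvexOn Set.univ c fun u ↦ ω u + c / 2 * ‖u - w‖ ^ 2 := by
  refine ⟨convex_univ, fun x _ y _ a b ha hb hab ↦ ?_⟩
  have h₁ := hω.2 (Set.mem_univ x) (Set.mem_univ y) ha hb hab
  have hpt : a • x + b • y - w = a • (x - w) + b • (y - w) := by
    linear_combination (norm := module) hab • w
  have hxy : x - y = (x - w) - (y - w) := by abel
  have h₂ : ‖a • x + b • y - w‖ ^ 2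
      = a * ‖x - w‖ ^ 2 + b * ‖y - w‖ ^ 2 - a * b * ‖x - y‖ ^ 2 := by
    rw [hpt, hxy, norm_add_sq_real, norm_sub_sq_real (x - w) (y - w), inner_smul_left,
      inner_smul_right, norm_smul, norm_smul, Real.norm_of_nonneg ha, Real.norm_of_nonneg hb]
    obtain rfl : b = 1 - a := by linarith
    simp only [conj_trivial]
    ring
  simp only [smul_eq_mul] at h₁ ⊢
  rw [h₂]
  linarith

theorem ConvexOn.prox_add_sq_le {c : ℝ} {ω : E → ℝ} (hω : ConvexOn ℝ Set.univ ω) {w p : E}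
    (hp : ∀ u, ω p + c / 2 * ‖p - w‖ ^ 2 ≤ ω u + c / 2 * ‖u - w‖ ^ 2) (u : E) :
    ω p + c / 2 * ‖p - w‖ ^ 2 + c / 2 * ‖u - p‖ ^ 2 ≤ ω u + c / 2 * ‖u - w‖ ^ 2 := by
  simpa using (hω.strongConvexOn_add_sq (c := c) w).add_inner_add_sq_le_of_subgradient (g := 0)
    (by simpa using hp) u

theorem ConvexOn.proximal_gradient_step {L m γ : ℝ} {φ ω : E → ℝ} (hω : ConvexOn ℝ Set.univ ω)
    {x p z d : E} (hγ : 0 < γ) (hγL : γ * L ≤ 1)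
    (hup : φ p ≤ φ x + ⟪d, p - x⟫ + L / 2 * ‖p - x‖ ^ 2)
    (hlow : φ x + ⟪d, z - x⟫ + m / 2 * ‖z - x‖ ^ 2 ≤ φ z)
    (hp : ∀ u, ω p + 1 / (2 * γ) * ‖p - (x - γ • d)‖ ^ 2
      ≤ ω u + 1 / (2 * γ) * ‖u - (x - γ • d)‖ ^ 2) :
    φ p + ω p + 1 / (2 * γ) * ‖p - z‖ ^ 2
      ≤ φ z + ω z + 1 / (2 * γ) * ((1 - γ * m) * ‖x - z‖ ^ 2) := by
  have hc : γ⁻¹ / 2 = 1 / (2 * γ) := by field_simp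
  have h₁ := hω.prox_add_sq_le (c := γ⁻¹) (by simpa only [hc] using hp) z
  have hexp (u : E) : γ⁻¹ / 2 * ‖u - (x - γ • d)‖ ^ 2
      = γ⁻¹ / 2 * ‖u - x‖ ^ 2 + ⟪d, u - x⟫ + γ / 2 * ‖d‖ ^ 2 := by
    rw [show u - (x - γ • d) = (u - x) + γ • d by abel, norm_add_sq_real, inner_smul_right,
      norm_smul, Real.norm_of_nonneg hγ.le, real_inner_comm]
    field_simp
  rw [hexp, hexp] at h₁
  have hL : L / 2 * ‖p - x‖ ^ 2 ≤ γ⁻¹ / 2 * ‖p - x‖ ^ 2 := by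
    have : L ≤ γ⁻¹ := by rwa [← one_div, le_div_iff₀' hγ]
    gcongr
  have hm : 1 / (2 * γ) * ((1 - γ * m) * ‖x - z‖ ^ 2)
      = γ⁻¹ / 2 * ‖z - x‖ ^ 2 - m / 2 * ‖z - x‖ ^ 2 := by
    rw [norm_sub_rev x z]
    field_simp
  rw [hm, ← hc, norm_sub_rev p z]
  linarith

theorem ConvexOn.weighted_average_sub_le {F : E → ℝ} (hF : ConvexOn ℝ Set.univ F) {x : ℕ → E}
    {z : E} {c q : ℝ} (hc : 0 ≤ c) (hq : 0 < q)
    (hstep : ∀ k, F (x (k + 1)) + c * ‖x (k + 1) - z‖ ^ 2 ≤ F z + c * (q * ‖x k - z‖ ^ 2))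
    {θ : ℕ → ℝ} (hθ : ∀ k, θ k = (q ^ (k + 1))⁻¹) {K : ℕ} (hK : 1 ≤ K) :
    F ((∑ j ∈ Finset.range K, θ j)⁻¹ • ∑ k ∈ Finset.range K, θ k • x (k + 1)) - F z
      ≤ c * ‖x 0 - z‖ ^ 2 * q ^ K := by
  have hθ_pos (k : ℕ) : 0 < θ k := by rw [hθ]; positivity
  set S := ∑ j ∈ Finset.range K, θ j with hS
  have hS_ge : (q ^ K)⁻¹ ≤ S := by
    have := Finset.single_le_sum (f := θ) (fun i _ ↦ (hθ_pos i).le)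
      (Finset.mem_range.2 (Nat.sub_lt hK one_pos))
    rwa [hθ (K - 1), Nat.sub_add_cancel hK] at this
  have hS_pos : 0 < S := lt_of_lt_of_le (by positivity) hS_ge
  have hsum (N : ℕ) : ∑ k ∈ Finset.range N, θ k * (F (x (k + 1)) - F z)
      ≤ c * ‖x 0 - z‖ ^ 2 - (q ^ N)⁻¹ * (c * ‖x N - z‖ ^ 2) := by
    induction N with
    | zero => simp
    | succ N ih =>
      rw [Finset.sum_range_succ]
      have h₁ := mul_le_mul_of_nonneg_left (hstep N) (hθ_pos N).le
      have h₂ : θ N * (c * (q * ‖x N - z‖ ^ 2)) = (q ^ N)⁻¹ * (c * ‖x N - z‖ ^ 2) := by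
        rw [hθ, pow_succ]
        field_simp
      rw [← hθ N]
      linarith
  have hjensen := hF.map_centerMass_le (t := Finset.range K) (w := θ) (p := fun k ↦ x (k + 1))
    (fun i _ ↦ (hθ_pos i).le) (by rwa [← hS]) (fun i _ ↦ Set.mem_univ _)
  simp only [Finset.centerMass, ← hS, smul_eq_mul, Function.comp_apply] at hjensen
  have hK_sum : ∑ k ∈ Finset.range K, θ k * F (x (k + 1)) ≤ c * ‖x 0 - z‖ ^ 2 + S * F z := by
    have h₁ := hsum K
    simp only [mul_sub, Finset.sum_sub_distrib, ← Finset.sum_mul, ← hS] at h₁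
    have : 0 ≤ (q ^ K)⁻¹ * (c * ‖x K - z‖ ^ 2) := by positivity
    linarith
  have hS_inv : S⁻¹ ≤ q ^ K := inv_le_of_inv_le₀ (by positivity) hS_ge
  calc _ ≤ S⁻¹ * (c * ‖x 0 - z‖ ^ 2 + S * F z) - F z := by
        gcongr
        exact hjensen.trans (by gcongr)
    _ = S⁻¹ * (c * ‖x 0 - z‖ ^ 2) := by field_simp; ring
    _ ≤ q ^ K * (c * ‖x 0 - z‖ ^ 2) := by gcongr
    _ = _ := mul_comm _ _

theorem neg_norm_mul_infDist_le_inner {X : Set E} (hX : X.Nonempty) {g z : E}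
    (hg : ∀ y ∈ X, 0 ≤ ⟪g, y - z⟫) (u : E) : -(‖g‖ * infDist u X) ≤ ⟪g, u - z⟫ := by
  rcases eq_or_ne g 0 with rfl | hg₀
  · simp
  have hg_pos : 0 < ‖g‖ := norm_pos_iff.2 hg₀
  have : -⟪g, u - z⟫ / ‖g‖ ≤ infDist u X := by
    refine (le_infDist hX).2 fun y hy ↦ ?_
    rw [div_le_iff₀' hg_pos, dist_eq_norm]
    have h₁ := abs_le.1 (abs_real_inner_le_norm g (u - y))
    have h₂ : ⟪g, u - z⟫ = ⟪g, u - y⟫ + ⟪g, y - z⟫ := by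
      rw [← inner_add_right, sub_add_sub_cancel]
    linarith [hg y hy]
  rw [div_le_iff₀' hg_pos] at this
  linarith

end ProximalGradient

theorem stmt_17
    {n : ℕ}
    (f h ωf ωh : EuclideanSpace ℝ (Fin n) → ℝ)
    (f' h' : EuclideanSpace ℝ (Fin n) → EuclideanSpace ℝ (Fin n))
    (Lf Lh μf : ℝ)
    (hμf_pos : 0 < μf) (hμf_le : μf ≤ Lf) (hLh_pos : 0 < Lh)
    (hf_grad : ∀ x, HasGradientAt f (f' x) x)
    (hf_lip : ∀ x y, ‖f' x - f' y‖ ≤ Lf * ‖x - y‖)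
    (hf_sc : StrongConvexOn Set.univ μf f)
    (hh_grad : ∀ x, HasGradientAt h (h' x) x)
    (hh_lip : ∀ x y, ‖h' x - h' y‖ ≤ Lh * ‖x - y‖)
    (hh_conv : ConvexOn ℝ Set.univ h)
    (hωf_conv : ConvexOn ℝ Set.univ ωf)
    (hωh_conv : ConvexOn ℝ Set.univ ωh)
    (fbar hbar : EuclideanSpace ℝ (Fin n) → ℝ)
    (hfbar : ∀ x, fbar x = f x + ωf x)
    (hhbar : ∀ x, hbar x = h x + ωh x)
    (X : Set (EuclideanSpace ℝ (Fin n)))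
    (hX : X = {z | ∀ y, hbar z ≤ hbar y})
    (hXne : X.Nonempty)
    (hstar : ℝ)
    (hhstar : IsGLB (Set.range hbar) hstar)
    (xstar : EuclideanSpace ℝ (Fin n))
    (hxstar_mem : xstar ∈ X)
    (hxstar_min : ∀ y ∈ X, fbar xstar ≤ fbar y)
    (g : EuclideanSpace ℝ (Fin n))
    (hg_sub : ∀ y, fbar xstar + ⟪g, y - xstar⟫ ≤ fbar y)
    (hg_opt : ∀ y ∈ X, (0:ℝ) ≤ ⟪g, y - xstar⟫)
    (x : ℕ → EuclideanSpace ℝ (Fin n))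
    (η γ : ℝ)
    (hγ_pos : 0 < γ)
    (hγ_le : γ ≤ 1 / (Lh + η * Lf))
    (hx_iter : ∀ k u,
      ωh (x (k+1)) + η * ωf (x (k+1))
        + 1 / (2*γ) * ‖x (k+1) - (x k - γ • (h' (x k) + η • f' (x k)))‖ ^ 2
      ≤ ωh u + η * ωf u
        + 1 / (2*γ) * ‖u - (x k - γ • (h' (x k) + η • f' (x k)))‖ ^ 2)
    (θ : ℕ → ℝ)
    (hθ : ∀ k : ℕ, θ k = ((1 - η * γ * μf) ^ (k+1))⁻¹)
    (xbar : ℕ → EuclideanSpace ℝ (Fin n))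
    (hxbar : ∀ K, xbar K = (∑ j ∈ Finset.range K, θ j)⁻¹ •
        ∑ k ∈ Finset.range K, θ k • x (k+1))
    (hη_pos : 0 < η)
    (α : ℝ) (hα : 0 < α)
    (hws : ∀ z, α * Metric.infDist z X ≤ hbar z - hstar)
    (hg_ne : g ≠ 0)
    (hηα : η ≤ α / (2 * ‖g‖))
    (q : ℝ) (hq : q = 1 - η * γ * μf) :
    ∀ K : ℕ, 1 ≤ K →
      (0 ≤ hbar (xbar K) - hstar
          ∧ hbar (xbar K) - hstar ≤ ‖x 0 - xstar‖ ^ 2 / γ * q ^ K)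
      ∧ Metric.infDist (xbar K) X ≤ ‖x 0 - xstar‖ ^ 2 / (α * γ) * q ^ K
      ∧ (-(‖x 0 - xstar‖ ^ 2 / (2 * η * γ)) * q ^ K ≤ fbar (xbar K) - fbar xstar
          ∧ fbar (xbar K) - fbar xstar ≤ ‖x 0 - xstar‖ ^ 2 / (2 * η * γ) * q ^ K)
      ∧ ‖xbar K - xstar‖ ^ 2 ≤ 2 * ‖x 0 - xstar‖ ^ 2 / (η * γ * μf) * q ^ K := by
  intro K hK
  have hLf_pos : 0 < Lf := hμf_pos.trans_le hμf_le
  have hγL : γ * (Lh + η * Lf) ≤ 1 := (le_div_iff₀ (by positivity)).1 hγ_le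
  have hq_pos : 0 < q := by
    have h₁ : η * γ * μf ≤ γ * (η * Lf) := by
      rw [mul_comm η γ, mul_assoc]
      gcongr
    have h₂ : 0 < γ * Lh := mul_pos hγ_pos hLh_pos
    rw [hq]
    linarith
  have hω_conv : ConvexOn ℝ Set.univ fun u ↦ ωh u + η * ωf u :=
    hωh_conv.add (hωf_conv.smul hη_pos.le)
  have hbar_conv : ConvexOn ℝ Set.univ hbar := by
    rw [show hbar = h + ωh from funext hhbar]
    exact hh_conv.add hωh_conv
  have hfbar_sc : StrongConvexOn Set.univ μf fbar := by
    rw [show fbar = f + ωf from funext hfbar]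
    simpa [StrongConvexOn] using UniformConvexOn.add hf_sc (uniformConvexOn_zero.2 hωf_conv)
  have hfbar_conv : ConvexOn ℝ Set.univ fbar := strongConvexOn_zero.1 (hfbar_sc.mono hμf_pos.le)
  have hF_conv : ConvexOn ℝ Set.univ fun u ↦ hbar u + η * fbar u :=
    hbar_conv.add (hfbar_conv.smul hη_pos.le)
  have hstep (k : ℕ) : hbar (x (k + 1)) + η * fbar (x (k + 1))
        + 1 / (2 * γ) * ‖x (k + 1) - xstar‖ ^ 2
      ≤ hbar xstar + η * fbar xstar + 1 / (2 * γ) * (q * ‖x k - xstar‖ ^ 2) := by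
    have hup_f := mul_le_mul_of_nonneg_left
      (le_add_inner_add_sq_of_lipschitz_gradient hf_grad hf_lip (x k) (x (k + 1))) hη_pos.le
    have hup_h := le_add_inner_add_sq_of_lipschitz_gradient hh_grad hh_lip (x k) (x (k + 1))
    have hlow_f := mul_le_mul_of_nonneg_left
      (hf_sc.add_inner_add_sq_le_of_hasGradientAt (hf_grad (x k)) xstar) hη_pos.le
    have hlow_h := (strongConvexOn_zero.2 hh_conv).add_inner_add_sq_le_of_hasGradientAt
      (hh_grad (x k)) xstar
    have h₁ := hω_conv.proximal_gradient_step (L := Lh + η * Lf) (m := η * μf)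
      (φ := fun u ↦ h u + η * f u) (x := x k) (p := x (k + 1)) (z := xstar)
      (d := h' (x k) + η • f' (x k)) hγ_pos hγL
      (by simp only [inner_add_left, real_inner_smul_left]; linarith)
      (by simp only [inner_add_left, real_inner_smul_left]; linarith) (hx_iter k)
    have h₂ : 1 - γ * (η * μf) = q := by rw [hq]; ring
    rw [h₂] at h₁
    simp only [hhbar, hfbar]
    linarith
  have havg := hF_conv.weighted_average_sub_le (c := 1 / (2 * γ)) (by positivity) hq_pos hstep
    (by rwa [hq]) hK
  rw [← hxbar K] at havg
  have hstar_eq : hbar xstar = hstar := by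
    rw [hX] at hxstar_mem
    exact (IsLeast.isGLB ⟨Set.mem_range_self xstar, by rintro _ ⟨y, rfl⟩; exact hxstar_mem y⟩).unique
      hhstar
  rw [hstar_eq] at havg
  set B := 1 / (2 * γ) * ‖x 0 - xstar‖ ^ 2 * q ^ K with hB
  have hws_K := hws (xbar K)
  have hdist_nonneg : 0 ≤ infDist (xbar K) X := infDist_nonneg
  have hgap_nonneg : 0 ≤ hbar (xbar K) - hstar :=
    (mul_nonneg hα.le hdist_nonneg).trans hws_K
  have hinner : -((hbar (xbar K) - hstar) / 2) ≤ η * ⟪g, xbar K - xstar⟫ := by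
    have h₁ := mul_le_mul_of_nonneg_left
      (neg_norm_mul_infDist_le_inner hXne hg_opt (xbar K)) hη_pos.le
    have h₂ : η * (2 * ‖g‖) ≤ α :=
      (le_div_iff₀ (mul_pos two_pos (norm_pos_iff.2 hg_ne))).1 hηα
    have h₃ := mul_le_mul_of_nonneg_right h₂ hdist_nonneg
    linarith
  have hgrowth := mul_le_mul_of_nonneg_left
    (hfbar_sc.add_inner_add_sq_le_of_subgradient hg_sub (xbar K)) hη_pos.le
  have hsq_nonneg : 0 ≤ η * (μf / 2 * ‖xbar K - xstar‖ ^ 2) := by positivity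
  have hgap_le : hbar (xbar K) - hstar ≤ 2 * B := by linarith
  have hf_le : η * (fbar (xbar K) - fbar xstar) ≤ B := by linarith
  have hf_ge : -B ≤ η * (fbar (xbar K) - fbar xstar) := by linarith
  have hsq_le : η * (μf / 2 * ‖xbar K - xstar‖ ^ 2) ≤ B := by linarith
  have hB₁ : ‖x 0 - xstar‖ ^ 2 / γ * q ^ K = 2 * B := by rw [hB]; field_simp
  have hB₂ : ‖x 0 - xstar‖ ^ 2 / (2 * η * γ) * q ^ K = B / η := by rw [hB]; field_simp
  refine ⟨⟨hgap_nonneg, hB₁ ▸ hgap_le⟩, ?_, ⟨?_, ?_⟩, ?_⟩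
  · have h₁ : ‖x 0 - xstar‖ ^ 2 / (α * γ) * q ^ K = 2 * B / α := by rw [hB]; field_simp
    rw [h₁, le_div_iff₀' hα]
    exact hws_K.trans hgap_le
  · rw [neg_mul, hB₂, ← neg_div, div_le_iff₀' hη_pos]
    exact hf_ge
  · rw [hB₂, le_div_iff₀' hη_pos]
    exact hf_le
  · have h₁ : 2 * ‖x 0 - xstar‖ ^ 2 / (η * γ * μf) * q ^ K = 4 * B / (η * μf) := by
      rw [hB]
      field_simp
      ring
    rw [h₁, le_div_iff₀' (by positivity)]
    linarith
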